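/- arXiv:math/9807118 — 2 statements merged into one kernel-verified Lean document; each statement's English description precedes it below -/
import Mathlib

section
/- There are uncountably many varieties of solvable groups with instances of nontrivial dominions: the collection of varieties 𝒱 of groups such that every group in 𝒱 is solvable and 𝒱 has instances of nontrivial dominions is uncountable. -/
/-- A bundled group: a type in universe `u` together with a group structure. -/
structure GroupT : Type (u + 1) where
  carrier : Type u
  [str : Group carrier]

attribute [instance] GroupT.str

/-- A variety of groups: a class of groups closed under isomorphism, subgroups,
homomorphic images, and arbitrary direct products indexed by types in the universe. -/
structure GroupVariety : Type (u + 1) where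
  Mem : GroupT.{u} → Prop
  iso_closed : ∀ {G H : GroupT.{u}}, G.carrier ≃* H.carrier → Mem G → Mem H
  subgroup_closed : ∀ (G : GroupT.{u}) (H : Subgroup G.carrier), Mem G → Mem ⟨H⟩
  quotient_closed : ∀ (G H : GroupT.{u}) (f : G.carrier →* H.carrier),
      Function.Surjective f → Mem G → Mem H
  pi_closed : ∀ (ι : Type u) (f : ι → GroupT.{u}),
      (∀ i, Mem (f i)) → Mem ⟨∀ i, (f i).carrier⟩

/-- A variety is nontrivial if it contains some nontrivial group and
does not contain all groups. -/
def GroupVariety.IsNontrivial (V : GroupVariety.{u}) : Prop :=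
  (∃ G : GroupT.{u}, V.Mem G ∧ Nontrivial G.carrier) ∧ ∃ G : GroupT.{u}, ¬ V.Mem G

/-- The dominion of a subgroup `H` of `G` relative to a class `C` of groups:
all elements of `G` on which any two homomorphisms into a `C`-group agreeing on `H`
must agree. -/
def dominion (C : GroupT.{u} → Prop) (G : Type u) [Group G] (H : Subgroup G) : Set G :=
  {a | ∀ K : GroupT.{u}, C K → ∀ f g : G →* K.carrier, (∀ h ∈ H, f h = g h) → f a = g a}

/-- The product variety `𝒩𝒬`: the class of groups having a normal subgroup in `𝒩`
with quotient in `𝒬`. -/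
def ProductVariety (N Q : GroupVariety.{u}) (G : GroupT.{u}) : Prop :=
  ∃ (M : Subgroup G.carrier) (h : M.Normal),
    N.Mem ⟨M⟩ ∧ (letI := h; Q.Mem ⟨G.carrier ⧸ M⟩)

/-- The verbal subgroup `𝒬(G)`: the intersection of all normal subgroups of `G`
whose quotient lies in `𝒬`. -/
def verbalSubgroup (Q : GroupVariety.{u}) (G : Type u) [Group G] : Subgroup G :=
  ⨅ M ∈ {M : Subgroup G | ∃ h : M.Normal, (letI := h; Q.Mem ⟨G ⧸ M⟩)}, M

/-- A class of groups has instances of nontrivial dominions if there is a group `G`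
in the class and a subgroup `H` of `G` strictly contained in its dominion in `G`. -/
def HasNontrivialDominions (C : GroupT.{u} → Prop) : Prop :=
  ∃ (G : GroupT.{u}) (H : Subgroup G.carrier),
    C G ∧ (H : Set G.carrier) ⊂ dominion C G.carrier H

open scoped commutatorElement

/-- The left-normed commutator `[u, z₀², z₁², …, z_{m-1}²]`. -/
def squareCommutator {G : Type*} [Group G] (u : G) (z : ℕ → G) : ℕ → G
  | 0 => u
  | m + 1 => ⁅squareCommutator u z m, z m ^ 2⁆

lemma map_squareCommutator {G H : Type*} [Group G] [Group H] (f : G →* H) (u : G) (z : ℕ → G)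
    (m : ℕ) : f (squareCommutator u z m) = squareCommutator (f u) (fun i => f (z i)) m := by
  induction m with
  | zero => rfl
  | succ m ih => simp only [squareCommutator, map_commutatorElement, ih, map_pow]

/-- The group satisfies `[u, [u, z₀², …, z_{m-1}²]] = 1` for every `u = [y, t₁, t₂, t₃]`. -/
def SatisfiesSquareLaw (m : ℕ) (G : Type*) [Group G] : Prop :=
  ∀ (y t₁ t₂ t₃ : G) (z : ℕ → G),
    ⁅⁅⁅⁅y, t₁⁆, t₂⁆, t₃⁆, squareCommutator ⁅⁅⁅y, t₁⁆, t₂⁆, t₃⁆ z m⁆ = 1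

/-- The laws defining the variety attached to a set `S` of natural numbers. -/
structure SatisfiesLaws (S : Set ℕ) (G : Type*) [Group G] : Prop where
  derived : derivedSeries G 4 = ⊥
  powers : ∀ x y z : G, ⁅⁅x ^ 4, y ^ 4⁆, z ^ 4⁆ = 1
  square : ∀ j ∈ S, SatisfiesSquareLaw (5 ^ (j + 1)) G

section Laws

variable {S : Set ℕ} {G H : Type*} [Group G] [Group H]

lemma SatisfiesLaws.of_injective (f : G →* H) (hf : Function.Injective f)
    (h : SatisfiesLaws S H) : SatisfiesLaws S G where
  derived := by
    have := map_derivedSeries_le_derivedSeries f 4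
    rw [h.derived, le_bot_iff, Subgroup.map_eq_bot_iff_of_injective _ hf] at this
    exact this
  powers x y z := hf (by simp only [map_commutatorElement, map_pow, map_one, h.powers])
  square j hj y t₁ t₂ t₃ z := hf (by
    simp only [map_commutatorElement, map_squareCommutator, map_one]
    exact h.square j hj _ _ _ _ _)

lemma SatisfiesLaws.of_surjective (f : G →* H) (hf : Function.Surjective f)
    (h : SatisfiesLaws S G) : SatisfiesLaws S H where
  derived := by rw [← map_derivedSeries_eq hf, h.derived, Subgroup.map_bot]
  powers x y z := by
    obtain ⟨x, rfl⟩ := hf x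
    obtain ⟨y, rfl⟩ := hf y
    obtain ⟨z, rfl⟩ := hf z
    simp only [← map_pow, ← map_commutatorElement, h.powers, map_one]
  square j hj y t₁ t₂ t₃ z := by
    obtain ⟨y, rfl⟩ := hf y
    obtain ⟨t₁, rfl⟩ := hf t₁
    obtain ⟨t₂, rfl⟩ := hf t₂
    obtain ⟨t₃, rfl⟩ := hf t₃
    choose z' hz using fun i => hf (z i)
    obtain rfl : (fun i => f (z' i)) = z := funext hz
    simp only [← map_commutatorElement, ← map_squareCommutator]
    rw [h.square j hj, map_one]

lemma SatisfiesLaws.pi {ι : Type*} {G : ι → Type*} [∀ i, Group (G i)]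
    (h : ∀ i, SatisfiesLaws S (G i)) : SatisfiesLaws S (∀ i, G i) where
  derived := by
    rw [eq_bot_iff]
    intro x hx
    rw [Subgroup.mem_bot]
    funext i
    have := map_derivedSeries_le_derivedSeries (Pi.evalMonoidHom G i) 4
      (Subgroup.mem_map_of_mem _ hx)
    rw [(h i).derived] at this
    simpa using this
  powers x y z := funext fun i => (h i).powers (x i) (y i) (z i)
  square j hj y t₁ t₂ t₃ z := funext fun i => by
    have := (h i).square j hj (y i) (t₁ i) (t₂ i) (t₃ i) (fun n => z n i)
    have h' : Pi.evalMonoidHom G i ⁅⁅⁅⁅y, t₁⁆, t₂⁆, t₃⁆,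
        squareCommutator ⁅⁅⁅y, t₁⁆, t₂⁆, t₃⁆ z (5 ^ (j + 1))⁆ = 1 := by
      simp only [map_commutatorElement, map_squareCommutator]
      exact this
    exact h'

end Laws

/-- The variety of groups defined by `SatisfiesLaws S`. -/
def lawVariety (S : Set ℕ) : GroupVariety.{u} where
  Mem G := SatisfiesLaws S G.carrier
  iso_closed e h := h.of_injective e.symm.toMonoidHom e.symm.injective
  subgroup_closed _ H h := h.of_injective H.subtype H.subtype_injective
  quotient_closed _ _ f hf h := h.of_surjective f hf
  pi_closed _ _ h := SatisfiesLaws.pi h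

/-- Commutators of fourth powers are compatible with taking squares whenever commutators of
fourth powers centralise fourth powers. -/
lemma commutator_pow_four_sq {K : Type*} [Group K]
    (hK : ∀ x y z : K, ⁅⁅x ^ 4, y ^ 4⁆, z ^ 4⁆ = 1) (a b : K) :
    ⁅a ^ 4, b ^ 4⁆ ^ 2 = ⁅a ^ 8, b ^ 4⁆ ∧ ⁅a ^ 4, b ^ 4⁆ ^ 2 = ⁅a ^ 4, b ^ 8⁆ := by
  have ha := commutatorElement_eq_one_iff_mul_comm.1 (hK a b a)
  have hb := commutatorElement_eq_one_iff_mul_comm.1 (hK a b b)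
  rw [show a ^ 8 = a ^ 4 * a ^ 4 by rw [← pow_add], show b ^ 8 = b ^ 4 * b ^ 4 by rw [← pow_add]]
  generalize a ^ 4 = x at *
  generalize b ^ 4 = y at *
  constructor
  · calc ⁅x, y⁆ ^ 2 = (⁅x, y⁆ * x) * y * x⁻¹ * y⁻¹ := by simp only [pow_two, commutatorElement_def]; group
      _ = ⁅x * x, y⁆ := by rw [ha]; simp only [commutatorElement_def]; group
  · calc ⁅x, y⁆ ^ 2 = x * y * x⁻¹ * y⁻¹ * ⁅x, y⁆ := by simp only [pow_two, commutatorElement_def]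
      _ = x * y * x⁻¹ * y⁻¹ * (⁅x, y⁆ * y) * y⁻¹ := by group
      _ = ⁅x, y * y⁆ := by rw [hb]; simp only [commutatorElement_def]; group

/-- The integral Heisenberg group. -/
@[ext] structure Heisenberg where
  x : ℤ
  y : ℤ
  z : ℤ

namespace Heisenberg

instance : Mul Heisenberg := ⟨fun a b => ⟨a.x + b.x, a.y + b.y, a.z + b.z + a.x * b.y⟩⟩
instance : One Heisenberg := ⟨⟨0, 0, 0⟩⟩
instance : Inv Heisenberg := ⟨fun a => ⟨-a.x, -a.y, -a.z + a.x * a.y⟩⟩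

@[simp] lemma mul_x (a b : Heisenberg) : (a * b).x = a.x + b.x := rfl
@[simp] lemma mul_y (a b : Heisenberg) : (a * b).y = a.y + b.y := rfl
@[simp] lemma mul_z (a b : Heisenberg) : (a * b).z = a.z + b.z + a.x * b.y := rfl
@[simp] lemma one_x : (1 : Heisenberg).x = 0 := rfl
@[simp] lemma one_y : (1 : Heisenberg).y = 0 := rfl
@[simp] lemma one_z : (1 : Heisenberg).z = 0 := rfl
@[simp] lemma inv_x (a : Heisenberg) : (a⁻¹).x = -a.x := rfl
@[simp] lemma inv_y (a : Heisenberg) : (a⁻¹).y = -a.y := rfl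
@[simp] lemma inv_z (a : Heisenberg) : (a⁻¹).z = -a.z + a.x * a.y := rfl

instance : Group Heisenberg :=
  Group.ofLeftAxioms
    (fun a b c => by ext <;> simp <;> ring)
    (fun a => by ext <;> simp)
    (fun a => by ext <;> simp)

lemma commutator_commutator (a b c : Heisenberg) : ⁅⁅a, b⁆, c⁆ = 1 := by
  ext
  · simp [commutatorElement_def]
  · simp [commutatorElement_def]
  · simp [commutatorElement_def]
    ring

lemma satisfiesLaws (S : Set ℕ) : SatisfiesLaws S Heisenberg where
  derived := by
    have h : derivedSeries Heisenberg 2 = ⊥ := by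
      have h1 : derivedSeries Heisenberg 1 ≤ Subgroup.center Heisenberg := by
        rw [derivedSeries_succ, Subgroup.commutator_le]
        intro a _ b _
        rw [Subgroup.mem_center_iff]
        exact fun c => (commutatorElement_eq_one_iff_mul_comm.1 (commutator_commutator a b c)).symm
      rw [eq_bot_iff, derivedSeries_succ, Subgroup.commutator_le]
      intro a ha b _
      rw [Subgroup.mem_bot, commutatorElement_eq_one_iff_mul_comm]
      exact (Subgroup.mem_center_iff.1 (h1 ha) b).symm
    rw [eq_bot_iff, ← h]
    exact derivedSeries_antitone _ (by norm_num)
  powers _ _ _ := commutator_commutator _ _ _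
  square _ _ _ _ _ _ _ := by
    simp only [commutator_commutator, commutatorElement_one_left]

/-- The subgroup of triples `(x, y, z)` with `8 ∣ x`, `8 ∣ y` and `64 ∣ z`. -/
def eighthPowers : Subgroup Heisenberg where
  carrier := {a | 8 ∣ a.x ∧ 8 ∣ a.y ∧ 64 ∣ a.z}
  mul_mem' := by
    rintro a b ⟨h1, h2, h3⟩ ⟨h4, h5, h6⟩
    exact ⟨dvd_add h1 h4, dvd_add h2 h5, dvd_add (dvd_add h3 h6) (mul_dvd_mul h1 h5)⟩
  one_mem' := ⟨dvd_zero _, dvd_zero _, dvd_zero _⟩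
  inv_mem' := by
    rintro a ⟨h1, h2, h3⟩
    exact ⟨h1.neg_right, h2.neg_right, dvd_add h3.neg_right (mul_dvd_mul h1 h2)⟩

end Heisenberg

lemma hasNontrivialDominions_lawVariety (S : Set ℕ) :
    HasNontrivialDominions (lawVariety.{u} S).Mem := by
  let e : ULift.{u} Heisenberg ≃* Heisenberg := MulEquiv.ulift
  let p : ULift.{u} Heisenberg := e.symm ⟨1, 0, 0⟩
  let q : ULift.{u} Heisenberg := e.symm ⟨0, 1, 0⟩
  refine ⟨⟨ULift.{u} Heisenberg⟩, Heisenberg.eighthPowers.comap e.toMonoidHom,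
    (Heisenberg.satisfiesLaws S).of_injective e.toMonoidHom e.injective, ?_⟩
  rw [Set.ssubset_iff_of_subset fun h hh K _ f g hfg => hfg h hh]
  refine ⟨⁅p ^ 4, q ^ 4⁆ ^ 2, fun K hK f g hfg => ?_, fun h => ?_⟩
  · have hp := hfg (p ^ 8) (by
      change e (p ^ 8) ∈ Heisenberg.eighthPowers
      simp [p, Heisenberg.eighthPowers, pow_succ])
    have hq := hfg (q ^ 8) (by
      change e (q ^ 8) ∈ Heisenberg.eighthPowers
      simp [q, Heisenberg.eighthPowers, pow_succ])
    simp only [map_pow] at hp hq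
    simp only [map_pow, map_commutatorElement]
    have hfp := commutator_pow_four_sq hK.powers (f p) (f q)
    have hm := commutator_pow_four_sq hK.powers (f p) (g q)
    have hgp := commutator_pow_four_sq hK.powers (g p) (g q)
    rw [hfp.2, hq, ← hm.2, hm.1, hp, ← hgp.1]
  · change e (⁅p ^ 4, q ^ 4⁆ ^ 2) ∈ Heisenberg.eighthPowers at h
    simp [p, q, Heisenberg.eighthPowers, pow_succ,
      commutatorElement_def] at h

/-- The cocycle pairing of two functions on `L` attached to a kernel `τ`. -/
def pairing {L : Type} [Group L] [Fintype L] (τ : L → L → ZMod 2) (u v : L → ZMod 2) :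
    L → ZMod 2 :=
  fun k => ∑ g, ∑ h, u g * v h * τ (k * g) (k * h)

/-- Left translation of functions. -/
def lsh {L : Type} [Group L] (k : L) (f : L → ZMod 2) : L → ZMod 2 := fun g => f (k⁻¹ * g)

/-- Right translation of functions. -/
def rsh {L : Type} [Group L] (k : L) (f : L → ZMod 2) : L → ZMod 2 := fun g => f (g * k)

section Translation

variable {L : Type} [Group L]

@[simp] lemma lsh_one (f : L → ZMod 2) : lsh 1 f = f := by funext; simp [lsh]
@[simp] lemma rsh_one (f : L → ZMod 2) : rsh 1 f = f := by funext; simp [rsh]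
lemma lsh_mul (k l : L) (f : L → ZMod 2) : lsh (k * l) f = lsh k (lsh l f) := by
  funext; simp [lsh, mul_assoc]
lemma rsh_mul (k l : L) (f : L → ZMod 2) : rsh (k * l) f = rsh k (rsh l f) := by
  funext; simp [rsh, mul_assoc]
lemma lsh_add (k : L) (f g : L → ZMod 2) : lsh k (f + g) = lsh k f + lsh k g := rfl
lemma rsh_add (k : L) (f g : L → ZMod 2) : rsh k (f + g) = rsh k f + rsh k g := rfl
@[simp] lemma lsh_zero (k : L) : lsh k (0 : L → ZMod 2) = 0 := rfl
@[simp] lemma rsh_zero (k : L) : rsh k (0 : L → ZMod 2) = 0 := rfl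
lemma lsh_sum {ι : Type*} (k : L) (s : Finset ι) (f : ι → L → ZMod 2) :
    lsh k (∑ i ∈ s, f i) = ∑ i ∈ s, lsh k (f i) := by
  funext; simp [lsh]

variable [Fintype L] (τ : L → L → ZMod 2)

lemma pairing_add_left (u u' v : L → ZMod 2) :
    pairing τ (u + u') v = pairing τ u v + pairing τ u' v := by
  funext k; simp [pairing, add_mul, Finset.sum_add_distrib]

lemma pairing_add_right (u v v' : L → ZMod 2) :
    pairing τ u (v + v') = pairing τ u v + pairing τ u v' := by
  funext k; simp [pairing, mul_add, add_mul, Finset.sum_add_distrib]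

@[simp] lemma pairing_zero_left (v : L → ZMod 2) : pairing τ 0 v = 0 := by
  funext k; simp [pairing]

@[simp] lemma pairing_zero_right (v : L → ZMod 2) : pairing τ v 0 = 0 := by
  funext k; simp [pairing]

lemma pairing_lsh (k : L) (u v : L → ZMod 2) :
    pairing τ (lsh k u) (lsh k v) = rsh k (pairing τ u v) := by
  funext l
  simp only [pairing, lsh, rsh]
  rw [← Equiv.sum_comp (Equiv.mulLeft k)]
  refine Finset.sum_congr rfl fun g _ => ?_
  rw [← Equiv.sum_comp (Equiv.mulLeft k)]
  simp [mul_assoc]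

end Translation

/-- The underlying set of the group of triples `(f, c, k)`, an extension of `L` by a nilpotent
group of class two whose multiplication is twisted by the kernel `τ`. -/
@[ext] structure TwistedExt {L : Type} [Group L] [Fintype L] (τ : L → L → ZMod 2) where
  f : L → ZMod 2
  c : L → ZMod 2
  k : L

namespace TwistedExt

variable {L : Type} [Group L] [Fintype L] {τ : L → L → ZMod 2}

instance : Mul (TwistedExt τ) where
  mul x y := ⟨x.f + lsh x.k y.f, x.c + rsh x.k y.c + pairing τ x.f (lsh x.k y.f), x.k * y.k⟩

instance : One (TwistedExt τ) where
  one := ⟨0, 0, 1⟩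

instance : Inv (TwistedExt τ) where
  inv x := ⟨lsh x.k⁻¹ x.f, rsh x.k⁻¹ (x.c + pairing τ x.f x.f), x.k⁻¹⟩

@[simp] lemma mul_f (x y : TwistedExt τ) : (x * y).f = x.f + lsh x.k y.f := rfl
@[simp] lemma mul_c (x y : TwistedExt τ) :
    (x * y).c = x.c + rsh x.k y.c + pairing τ x.f (lsh x.k y.f) := rfl
@[simp] lemma mul_k (x y : TwistedExt τ) : (x * y).k = x.k * y.k := rfl
@[simp] lemma one_f : (1 : TwistedExt τ).f = 0 := rfl
@[simp] lemma one_c : (1 : TwistedExt τ).c = 0 := rfl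
@[simp] lemma one_k : (1 : TwistedExt τ).k = 1 := rfl
@[simp] lemma inv_f (x : TwistedExt τ) : (x⁻¹).f = lsh x.k⁻¹ x.f := rfl
@[simp] lemma inv_c (x : TwistedExt τ) :
    (x⁻¹).c = rsh x.k⁻¹ (x.c + pairing τ x.f x.f) := rfl
@[simp] lemma inv_k (x : TwistedExt τ) : (x⁻¹).k = x.k⁻¹ := rfl

instance : Group (TwistedExt τ) :=
  Group.ofLeftAxioms
    (fun x y z => by
      ext1
      · simp [lsh_add, lsh_mul, add_assoc]
      · simp only [mul_c, mul_f, mul_k, lsh_add, rsh_add, lsh_mul, rsh_mul, pairing_add_left,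
          pairing_add_right, pairing_lsh]
        abel
      · simp [mul_assoc])
    (fun x => by ext1 <;> simp)
    (fun x => by
      ext1
      · simp [CharTwo.add_self_eq_zero]
      · simp only [mul_c, inv_c, inv_k, inv_f, one_c, pairing_lsh, rsh_add]
        have h := CharTwo.add_self_eq_zero (rsh x.k⁻¹ x.c)
        have h' := CharTwo.add_self_eq_zero (rsh x.k⁻¹ (pairing τ x.f x.f))
        linear_combination (exp := 1) h + h'
      · simp)

/-- The projection onto `L`. -/
def proj (τ : L → L → ZMod 2) : TwistedExt τ →* L where
  toFun := k
  map_one' := rfl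
  map_mul' _ _ := rfl

@[simp] lemma proj_apply (x : TwistedExt τ) : proj τ x = x.k := rfl

lemma commutator_k (x y : TwistedExt τ) : ⁅x, y⁆.k = ⁅x.k, y.k⁆ := map_commutatorElement (proj τ) x y

lemma pow_k (x : TwistedExt τ) (n : ℕ) : (x ^ n).k = x.k ^ n := map_pow (proj τ) x n

lemma commutator_f {u : TwistedExt τ} (hu : u.k = 1) (g : TwistedExt τ) :
    ⁅u, g⁆.f = u.f + lsh g.k u.f := by
  have h := CharTwo.add_self_eq_zero g.f
  simp only [commutatorElement_def, mul_f, mul_k, inv_f, inv_k, hu, lsh_one, one_mul, inv_one,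
    mul_one, ← lsh_mul, mul_inv_cancel]
  linear_combination (exp := 1) h

lemma commutator_of_mem {u v : TwistedExt τ} (hu : u.k = 1) (hv : v.k = 1) :
    ⁅u, v⁆.f = 0 ∧ ⁅u, v⁆.k = 1 := by
  refine ⟨?_, by simp [commutator_k, hu, hv]⟩
  rw [commutator_f hu, hv, lsh_one, CharTwo.add_self_eq_zero]

lemma mul_comm_of_f_eq_zero {u v : TwistedExt τ} (hu : u.k = 1) (hu' : u.f = 0) (hv : v.k = 1) :
    u * v = v * u := by
  ext1 <;> simp [hu, hu', hv, add_comm]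

lemma commutator_eq_one_iff_pairing {u v : TwistedExt τ} (hu : u.k = 1) (hv : v.k = 1) :
    ⁅u, v⁆ = 1 ↔ pairing τ u.f v.f = pairing τ v.f u.f := by
  rw [commutatorElement_eq_one_iff_mul_comm, TwistedExt.ext_iff]
  simp [hu, hv, add_comm]

lemma derivedSeries_four (h : derivedSeries L 2 = ⊥) : derivedSeries (TwistedExt τ) 4 = ⊥ := by
  have h2 : ∀ x ∈ derivedSeries (TwistedExt τ) 2, x.k = 1 := by
    intro x hx
    have := map_derivedSeries_le_derivedSeries (proj τ) 2 (Subgroup.mem_map_of_mem _ hx)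
    rw [h] at this
    simpa using this
  let K : Subgroup (TwistedExt τ) :=
    { carrier := {x | x.f = 0 ∧ x.k = 1}
      mul_mem' := by rintro a b ⟨h1, h2⟩ ⟨h3, h4⟩; simp [h1, h2, h3, h4]
      one_mem' := by simp
      inv_mem' := by rintro a ⟨h1, h2⟩; simp [h1, h2] }
  have h3 : derivedSeries (TwistedExt τ) 3 ≤ K := by
    rw [derivedSeries_succ, Subgroup.commutator_le]
    exact fun a ha b hb => commutator_of_mem (h2 a ha) (h2 b hb)
  rw [eq_bot_iff, derivedSeries_succ, Subgroup.commutator_le]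
  intro a ha b hb
  rw [Subgroup.mem_bot, commutatorElement_eq_one_iff_mul_comm]
  exact mul_comm_of_f_eq_zero (h3 ha).2 (h3 ha).1 (h3 hb).2

end TwistedExt

lemma ZMod.two_mul_self (a : ZMod 2) : a * a = a := by
  revert a; decide

/-- In characteristic two a symmetric double sum reduces to its diagonal. -/
lemma sum_sum_eq_sum_diagonal {L : Type*} [Fintype L] (M : L → L → ZMod 2)
    (hM : ∀ g h, M g h = M h g) : ∑ g, ∑ h, M g h = ∑ g, M g g := by
  classical
  have key : ∑ p : L × L, (M p.1 p.2 - if p.1 = p.2 then M p.1 p.2 else 0) = 0 := by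
    refine Finset.sum_involution (fun p _ => p.swap) ?_ ?_ (fun _ _ => Finset.mem_univ _)
      (fun p _ => p.swap_swap)
    · rintro ⟨g, h⟩ -
      simp only [Prod.swap, eq_comm (a := h) (b := g), hM h g]
      exact CharTwo.add_self_eq_zero _
    · rintro ⟨g, h⟩ - hne hs
      obtain rfl : h = g := congrArg Prod.fst hs
      simp at hne
  rw [Finset.sum_sub_distrib, sub_eq_zero, Fintype.sum_prod_type, Fintype.sum_prod_type] at key
  simpa using key

/-- The bilinear form on functions attached to a function on the group. -/
def groupForm {L : Type} [Group L] [Fintype L] (ψ : L → ZMod 2) (u v : L → ZMod 2) : ZMod 2 :=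
  ∑ g, ∑ h, u g * v h * ψ (g⁻¹ * h)

section GroupForm

variable {L : Type} [Group L] [Fintype L] {ψ : L → ZMod 2}

lemma exists_kernel (hinv : ∀ g, ψ g⁻¹ = ψ g) (hone : ψ 1 = 0) :
    ∃ τ : L → L → ZMod 2, ∀ g h, τ g h + τ h g = ψ (g⁻¹ * h) := by
  let e := Fintype.equivFin L
  refine ⟨fun g h => if e g < e h then ψ (g⁻¹ * h) else 0, fun g h => ?_⟩
  have hs : ψ (h⁻¹ * g) = ψ (g⁻¹ * h) := by rw [← hinv]; simp
  rcases lt_trichotomy (e g) (e h) with hlt | heq | hlt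
  · simp [hlt, hlt.not_gt]
  · obtain rfl := e.injective heq
    simp [hone]
  · simp [hlt, hlt.not_gt, hs]

lemma pairing_eq_iff_groupForm {τ : L → L → ZMod 2}
    (hτ : ∀ g h, τ g h + τ h g = ψ (g⁻¹ * h)) (u v : L → ZMod 2) :
    pairing τ u v = pairing τ v u ↔ groupForm ψ u v = 0 := by
  have key : ∀ k, pairing τ u v k + pairing τ v u k = groupForm ψ u v := by
    intro k
    simp only [pairing, groupForm]
    rw [Finset.sum_comm (f := fun g h => v g * u h * _), ← Finset.sum_add_distrib]
    refine Finset.sum_congr rfl fun g _ => ?_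
    rw [← Finset.sum_add_distrib]
    refine Finset.sum_congr rfl fun h _ => ?_
    have := hτ (k * g) (k * h)
    rw [show (k * g)⁻¹ * (k * h) = g⁻¹ * h by group] at this
    rw [← this]
    ring
  constructor
  · intro h
    rw [← key 1, h, CharTwo.add_self_eq_zero]
  · intro h
    funext k
    rw [← CharTwo.add_eq_zero, key, h]

lemma groupForm_sum_right {ι : Type*} (s : Finset ι) (u : L → ZMod 2) (v : ι → L → ZMod 2) :
    groupForm ψ u (∑ i ∈ s, v i) = ∑ i ∈ s, groupForm ψ u (v i) := by
  simp only [groupForm, Finset.sum_apply, Finset.mul_sum, Finset.sum_mul]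
  rw [Finset.sum_comm]
  rw [Finset.sum_congr rfl fun h _ => Finset.sum_comm, Finset.sum_comm]
  rw [Finset.sum_congr rfl fun h _ => Finset.sum_comm]

lemma groupForm_lsh_self (hinv : ∀ g, ψ g⁻¹ = ψ g) {ρ : L} (hρ : ρ * ρ = 1) (a : L → ZMod 2) :
    groupForm ψ a (lsh ρ a) = ∑ g, a g * ψ (g⁻¹ * ρ * g) := by
  have h1 : groupForm ψ a (lsh ρ a) = ∑ g, ∑ h, a g * a h * ψ (g⁻¹ * ρ * h) := by
    refine Finset.sum_congr rfl fun g _ => ?_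
    rw [← Equiv.sum_comp (Equiv.mulLeft ρ)]
    simp [lsh, mul_assoc]
  rw [h1, sum_sum_eq_sum_diagonal]
  · simp only [ZMod.two_mul_self]
  · intro g h
    rw [mul_comm (a g), ← hinv]
    simp [mul_assoc, inv_eq_of_mul_eq_one_left hρ]

end GroupForm

namespace TwistedExt

variable {L : Type} [Group L] [Fintype L] {ψ : L → ZMod 2} {τ : L → L → ZMod 2}
  {T : Type*} [AddCommMonoid T] {θ : T → L}

lemma squareCommutator_f (hθ : θ 0 = 1) (hθ' : ∀ s t, θ (s + t) = θ s * θ t)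
    {u : TwistedExt τ} (hu : u.k = 1) {z : ℕ → TwistedExt τ} {t : ℕ → T}
    (hz : ∀ i, (z i).k ^ 2 = θ (t i)) (m : ℕ) :
    (squareCommutator u z m).k = 1 ∧ (squareCommutator u z m).f =
      ∑ S ∈ (Finset.range m).powerset, lsh (θ (∑ i ∈ S, t i)) u.f := by
  induction m with
  | zero => simp [squareCommutator, hu, hθ]
  | succ m ih =>
    refine ⟨by simp [squareCommutator, commutator_k, ih.1], ?_⟩
    rw [squareCommutator, commutator_f ih.1, ih.2, Finset.range_add_one,
      Finset.sum_powerset_insert Finset.notMem_range_self, lsh_sum, pow_k, hz]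
    congr 1
    refine Finset.sum_congr rfl fun S hS => ?_
    rw [Finset.sum_insert fun h => Finset.notMem_range_self (Finset.mem_powerset.1 hS h), hθ',
      lsh_mul]

lemma commutator_squareCommutator_eq_one_iff (hinv : ∀ g, ψ g⁻¹ = ψ g)
    (hτ : ∀ g h, τ g h + τ h g = ψ (g⁻¹ * h))
    (hθ : θ 0 = 1) (hθ' : ∀ s t, θ (s + t) = θ s * θ t) (hθ'' : ∀ s, θ s * θ s = 1)
    {u : TwistedExt τ} (hu : u.k = 1) {z : ℕ → TwistedExt τ} {t : ℕ → T}
    (hz : ∀ i, (z i).k ^ 2 = θ (t i)) (m : ℕ) :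
    ⁅u, squareCommutator u z m⁆ = 1 ↔
      ∑ g, u.f g * ∑ S ∈ (Finset.range m).powerset, ψ (g⁻¹ * θ (∑ i ∈ S, t i) * g) = 0 := by
  obtain ⟨h1, h2⟩ := squareCommutator_f hθ hθ' hu hz m
  rw [commutator_eq_one_iff_pairing hu h1, pairing_eq_iff_groupForm hτ, h2, groupForm_sum_right]
  simp only [groupForm_lsh_self hinv (hθ'' _), Finset.mul_sum]
  rw [Finset.sum_comm]

end TwistedExt

lemma sum_powerset_det_sum_eq_zero {n m : ℕ} (hnm : n < m)
    (N : ℕ → Matrix (Fin n) (Fin n) (ZMod 2)) :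
    ∑ S ∈ (Finset.range m).powerset, (∑ i ∈ S, N i).det = 0 := by
  have hdet : ∀ S ∈ (Finset.range m).powerset, (∑ i ∈ S, N i).det =
      ∑ σ : Equiv.Perm (Fin n), ∑ p ∈ Fintype.piFinset fun _ : Fin n => Finset.range m,
        (σ.sign : ℤ) * ∏ j, if p j ∈ S then N (p j) (σ j) j else 0 := by
    intro S hS
    rw [Matrix.det_apply']
    refine Finset.sum_congr rfl fun σ _ => ?_
    rw [← Finset.mul_sum, ← Finset.prod_univ_sum (fun _ => Finset.range m)
      fun j i => if i ∈ S then N i (σ j) j else 0]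
    congr 1
    refine Finset.prod_congr rfl fun j _ => ?_
    rw [Matrix.sum_apply, ← Finset.sum_filter]
    congr 1
    ext i
    have := Finset.mem_powerset.1 hS
    simp only [Finset.mem_filter]
    exact ⟨fun h => ⟨this h, h⟩, fun h => h.2⟩
  rw [Finset.sum_congr rfl hdet, Finset.sum_comm]
  refine Finset.sum_eq_zero fun σ _ => ?_
  rw [Finset.sum_comm]
  refine Finset.sum_eq_zero fun p _ => ?_
  rw [← Finset.mul_sum]
  obtain ⟨i, hi, hip⟩ : ∃ i ∈ Finset.range m, i ∉ Finset.univ.image p := by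
    by_contra! h
    have h1 := Finset.card_le_card (show Finset.range m ⊆ Finset.univ.image p from h)
    have h2 := (Finset.card_image_le (s := Finset.univ) (f := p))
    rw [Finset.card_range] at h1
    rw [Finset.card_univ, Fintype.card_fin] at h2
    omega
  rw [← Finset.insert_erase hi, Finset.sum_powerset_insert (Finset.notMem_erase _ _)]
  have hp : ∀ j, p j ≠ i := fun j h => hip (Finset.mem_image.2 ⟨j, Finset.mem_univ _, h⟩)
  simp only [Finset.mem_insert, hp, false_or]
  rw [CharTwo.add_self_eq_zero, mul_zero]

lemma Matrix.rank_add_le_add {m n K : Type*} [Fintype m] [Fintype n] [Field K]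
    (A B : Matrix m n K) : (A + B).rank ≤ A.rank + B.rank := by
  have h : LinearMap.range (A + B).mulVecLin ≤
      LinearMap.range A.mulVecLin ⊔ LinearMap.range B.mulVecLin := by
    rintro _ ⟨v, rfl⟩
    rw [Matrix.mulVecLin_add]
    exact Submodule.add_mem_sup ⟨v, rfl⟩ ⟨v, rfl⟩
  exact (Submodule.finrank_mono h).trans (Submodule.finrank_add_le_finrank_add_finrank _ _)

lemma matrix_add_self {m n : Type*} (A : Matrix m n (ZMod 2)) : A + A = 0 := by
  ext i j
  exact CharTwo.add_self_eq_zero _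

lemma rank_sum_mul_le {n : ℕ} (S : Finset ℕ) (a : ℕ → Matrix (Fin n) Unit (ZMod 2))
    (b : ℕ → Matrix Unit (Fin n) (ZMod 2)) : (∑ i ∈ S, a i * b i).rank ≤ S.card := by
  induction S using Finset.induction_on with
  | empty => simp
  | insert i S hi ih =>
    rw [Finset.sum_insert hi, Finset.card_insert_of_notMem hi, add_comm]
    refine (Matrix.rank_add_le_add _ _).trans (add_le_add ih ?_)
    exact (Matrix.rank_mul_le_left _ _).trans ((Matrix.rank_le_card_width _).trans (by simp))

/-- The group of block unitriangular matrices over `ZMod 2` with blocks of sizes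
`n`, `1`, `n`, `n`. -/
@[ext] structure BlockUnitri (n : ℕ) where
  a : Matrix (Fin n) Unit (ZMod 2)
  b : Matrix Unit (Fin n) (ZMod 2)
  c : Matrix (Fin n) (Fin n) (ZMod 2)
  s : Matrix (Fin n) (Fin n) (ZMod 2)
  d : Matrix Unit (Fin n) (ZMod 2)
  e : Matrix (Fin n) (Fin n) (ZMod 2)

namespace BlockUnitri

variable {n : ℕ}

instance : Mul (BlockUnitri n) where
  mul x y := ⟨x.a + y.a, x.b + y.b, x.c + y.c, x.s + y.s + x.a * y.b, x.d + y.d + x.b * y.c,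
    x.e + y.e + x.a * y.d + x.s * y.c⟩

instance : One (BlockUnitri n) where
  one := ⟨0, 0, 0, 0, 0, 0⟩

instance : Inv (BlockUnitri n) where
  inv x := ⟨-x.a, -x.b, -x.c, -x.s + x.a * x.b, -x.d + x.b * x.c,
    -x.e + x.a * x.d + x.s * x.c - x.a * x.b * x.c⟩

@[simp] lemma mul_a (x y : BlockUnitri n) : (x * y).a = x.a + y.a := rfl
@[simp] lemma mul_b (x y : BlockUnitri n) : (x * y).b = x.b + y.b := rfl
@[simp] lemma mul_c (x y : BlockUnitri n) : (x * y).c = x.c + y.c := rfl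
@[simp] lemma mul_s (x y : BlockUnitri n) : (x * y).s = x.s + y.s + x.a * y.b := rfl
@[simp] lemma mul_d (x y : BlockUnitri n) : (x * y).d = x.d + y.d + x.b * y.c := rfl
@[simp] lemma mul_e (x y : BlockUnitri n) :
    (x * y).e = x.e + y.e + x.a * y.d + x.s * y.c := rfl
@[simp] lemma one_a : (1 : BlockUnitri n).a = 0 := rfl
@[simp] lemma one_b : (1 : BlockUnitri n).b = 0 := rfl
@[simp] lemma one_c : (1 : BlockUnitri n).c = 0 := rfl
@[simp] lemma one_s : (1 : BlockUnitri n).s = 0 := rfl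
@[simp] lemma one_d : (1 : BlockUnitri n).d = 0 := rfl
@[simp] lemma one_e : (1 : BlockUnitri n).e = 0 := rfl
@[simp] lemma inv_a (x : BlockUnitri n) : (x⁻¹).a = -x.a := rfl
@[simp] lemma inv_b (x : BlockUnitri n) : (x⁻¹).b = -x.b := rfl
@[simp] lemma inv_c (x : BlockUnitri n) : (x⁻¹).c = -x.c := rfl
@[simp] lemma inv_s (x : BlockUnitri n) : (x⁻¹).s = -x.s + x.a * x.b := rfl
@[simp] lemma inv_d (x : BlockUnitri n) : (x⁻¹).d = -x.d + x.b * x.c := rfl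
@[simp] lemma inv_e (x : BlockUnitri n) :
    (x⁻¹).e = -x.e + x.a * x.d + x.s * x.c - x.a * x.b * x.c := rfl

instance : Group (BlockUnitri n) :=
  Group.ofLeftAxioms
    (fun x y z => by
      ext1 <;> simp only [mul_a, mul_b, mul_c, mul_s, mul_d, mul_e, Matrix.mul_add,
        Matrix.add_mul, Matrix.mul_assoc] <;> abel)
    (fun x => by ext1 <;> simp)
    (fun x => by
      ext1 <;> simp only [mul_a, mul_b, mul_c, mul_s, mul_d, mul_e, inv_a, inv_b, inv_c, inv_s,
        inv_d, inv_e, one_a, one_b, one_c, one_s, one_d, one_e, Matrix.add_mul, Matrix.neg_mul, Matrix.mul_assoc] <;> abel)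

noncomputable instance : Fintype (BlockUnitri n) :=
  Fintype.ofInjective (fun x => (x.a, x.b, x.c, x.s, x.d, x.e)) fun x y h => by
    simp only [Prod.mk.injEq] at h
    obtain ⟨h1, h2, h3, h4, h5, h6⟩ := h
    exact BlockUnitri.ext h1 h2 h3 h4 h5 h6

lemma commutator_eq_of_a_b_c (x y : BlockUnitri n) :
    ⁅x, y⁆.a = 0 ∧ ⁅x, y⁆.b = 0 ∧ ⁅x, y⁆.c = 0 := by
  refine ⟨?_, ?_, ?_⟩ <;>
    simp only [commutatorElement_def, mul_a, mul_b, mul_c, inv_a, inv_b, inv_c] <;> abel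

lemma derivedSeries_two : derivedSeries (BlockUnitri n) 2 = ⊥ := by
  let K : Subgroup (BlockUnitri n) :=
    { carrier := {x | x.a = 0 ∧ x.b = 0 ∧ x.c = 0}
      mul_mem' := by rintro x y ⟨h1, h2, h3⟩ ⟨h4, h5, h6⟩; simp [h1, h2, h3, h4, h5, h6]
      one_mem' := by simp
      inv_mem' := by rintro x ⟨h1, h2, h3⟩; simp [h1, h2, h3] }
  have h1 : derivedSeries (BlockUnitri n) 1 ≤ K := by
    rw [derivedSeries_succ, Subgroup.commutator_le]
    exact fun x _ y _ => commutator_eq_of_a_b_c x y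
  rw [eq_bot_iff, derivedSeries_succ, Subgroup.commutator_le]
  intro x hx y hy
  obtain ⟨hx1, hx2, hx3⟩ := h1 hx
  obtain ⟨hy1, hy2, hy3⟩ := h1 hy
  rw [Subgroup.mem_bot, commutatorElement_eq_one_iff_mul_comm]
  ext1 <;> simp [hx1, hx2, hx3, hy1, hy2, hy3, add_comm]

lemma commutator_four (y t₁ t₂ t₃ : BlockUnitri n) : ⁅⁅⁅y, t₁⁆, t₂⁆, t₃⁆ = 1 := by
  obtain ⟨h1, h2, h3⟩ := commutator_eq_of_a_b_c y t₁
  generalize ⁅y, t₁⁆ = x at *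
  obtain ⟨h4, h5, h6⟩ := commutator_eq_of_a_b_c x t₂
  have h7 : ⁅x, t₂⁆.s = 0 := by simp [commutatorElement_def, h1, h2]
  have h8 : ⁅x, t₂⁆.d = 0 := by simp [commutatorElement_def, h2, h3]
  generalize ⁅x, t₂⁆ = w at *
  rw [commutatorElement_eq_one_iff_mul_comm]
  ext1 <;> simp [h4, h5, h6, h7, h8, add_comm]

/-- The triples of matrices parametrising the elements with `a = b = c = 0`. -/
abbrev Core (n : ℕ) : Type :=
  Matrix (Fin n) (Fin n) (ZMod 2) × Matrix Unit (Fin n) (ZMod 2) × Matrix (Fin n) (Fin n) (ZMod 2)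

/-- The element with `a = b = c = 0` and prescribed `s`, `d`, `e`. -/
def ofCore (t : Core n) : BlockUnitri n := ⟨0, 0, 0, t.1, t.2.1, t.2.2⟩

lemma ofCore_zero : ofCore (0 : Core n) = 1 := rfl

lemma ofCore_add (s t : Core n) : ofCore (s + t) = ofCore s * ofCore t := by
  ext1 <;> simp [ofCore]

lemma ofCore_mul_self (t : Core n) : ofCore t * ofCore t = 1 := by
  ext1 <;> simp [ofCore, matrix_add_self]

/-- The parameters of the square of an element. -/
def sqCore (z : BlockUnitri n) : Core n := (z.a * z.b, z.b * z.c, z.a * z.d + z.s * z.c)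

lemma sq_eq_ofCore (z : BlockUnitri n) : z ^ 2 = ofCore (sqCore z) := by
  rw [pow_two]
  ext1 <;> simp [ofCore, sqCore, matrix_add_self]

lemma pow_four (z : BlockUnitri n) : z ^ 4 = 1 := by
  rw [show 4 = 2 * 2 from rfl, pow_mul, sq_eq_ofCore z, pow_two, ofCore_mul_self]

lemma conj_ofCore (g : BlockUnitri n) (t : Core n) :
    g⁻¹ * ofCore t * g = ofCore (t.1, t.2.1, t.2.2 + t.1 * g.c - g.a * t.2.1) := by
  rw [mul_assoc, inv_mul_eq_iff_eq_mul]
  ext1 <;> simp [ofCore, add_comm]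
  abel

/-- The indicator of the first three indices. -/
def headIndicator (n : ℕ) (j : Fin n) : ZMod 2 := if (j : ℕ) < 3 then 1 else 0

/-- The indicator of the remaining indices. -/
def tailIndicator (n : ℕ) (j : Fin n) : ZMod 2 := if (j : ℕ) < 3 then 0 else 1

/-- The matrix with the first three columns of `e` and the remaining columns of `s`. -/
def mix (s e : Matrix (Fin n) (Fin n) (ZMod 2)) : Matrix (Fin n) (Fin n) (ZMod 2) :=
  s * Matrix.diagonal (tailIndicator n) + e * Matrix.diagonal (headIndicator n)

lemma det_mix_eq_zero {s : Matrix (Fin n) (Fin n) (ZMod 2)} (hs : s.rank + 3 < n)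
    (e : Matrix (Fin n) (Fin n) (ZMod 2)) : (mix s e).det = 0 := by
  by_contra h
  have h1 : (mix s e).rank = n := by
    rw [Matrix.rank_of_isUnit _ ((Matrix.isUnit_iff_isUnit_det _).2 (Ne.isUnit h)),
      Fintype.card_fin]
  have h2 : (Matrix.diagonal (headIndicator n)).rank ≤ 3 := by
    rw [Matrix.rank_diagonal, Fintype.card_subtype]
    refine (Finset.card_le_card_of_injOn (t := Finset.range 3) (fun j : Fin n => (j : ℕ)) ?_
      (Fin.val_injective.injOn)).trans (by simp)
    intro j hj
    simp [headIndicator] at hj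
    simpa using hj
  have h3 := Matrix.rank_add_le_add (s * Matrix.diagonal (tailIndicator n))
    (e * Matrix.diagonal (headIndicator n))
  have h4 := Matrix.rank_mul_le_left s (Matrix.diagonal (tailIndicator n))
  have h5 := Matrix.rank_mul_le_right e (Matrix.diagonal (headIndicator n))
  change (mix s e).rank ≤ _ at h3
  omega

open Classical in
/-- The function on the group used to twist the extension. -/
noncomputable def twist (x : BlockUnitri n) : ZMod 2 := if x * x = 1 then (mix x.s x.e).det else 0

lemma twist_inv (x : BlockUnitri n) : twist x⁻¹ = twist x := by
  by_cases h : x * x = 1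
  · rw [inv_eq_of_mul_eq_one_left h]
  · have h' : ¬ x⁻¹ * x⁻¹ = 1 := by rwa [← mul_inv_rev, inv_eq_one]
    simp [twist, h, h']

lemma twist_one (hn : n ≠ 0) : twist (1 : BlockUnitri n) = 0 := by
  have : Nonempty (Fin n) := ⟨⟨0, Nat.pos_of_ne_zero hn⟩⟩
  simp [twist, mix, Matrix.det_zero]

/-- The additive map taking the parameters of `x` to the matrix whose determinant is the twist
of the conjugate of `x` by `g`. -/
def conjMix (g : BlockUnitri n) : Core n →+ Matrix (Fin n) (Fin n) (ZMod 2) where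
  toFun t := mix t.1 (t.2.2 + t.1 * g.c - g.a * t.2.1)
  map_zero' := by simp [mix]
  map_add' s t := by simp [mix, Matrix.add_mul, Matrix.mul_add, Matrix.sub_mul]; abel

lemma twist_conj_ofCore (g : BlockUnitri n) (t : Core n) :
    twist (g⁻¹ * ofCore t * g) = (conjMix g t).det := by
  rw [conj_ofCore, twist, if_pos (ofCore_mul_self _)]
  rfl

lemma sum_det_conjMix_eq_zero {m : ℕ} (h : m + 3 < n ∨ n < m) (g : BlockUnitri n)
    (z : ℕ → BlockUnitri n) :
    ∑ S ∈ (Finset.range m).powerset, (conjMix g (∑ i ∈ S, sqCore (z i))).det = 0 := by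
  rcases h with h | h
  · refine Finset.sum_eq_zero fun S hS => det_mix_eq_zero ?_ _
    have h1 := rank_sum_mul_le S (fun i => (z i).a) fun i => (z i).b
    have h2 := Finset.card_le_card (Finset.mem_powerset.1 hS)
    rw [Finset.card_range] at h2
    rw [Prod.fst_sum]
    change (∑ i ∈ S, (z i).a * (z i).b).rank + 3 < n
    omega
  · simp only [map_sum]
    exact sum_powerset_det_sum_eq_zero h _

/-- The element whose only nontrivial block is the diagonal matrix `c` with entries `γ`. -/
def ofDiagonal (γ : Fin n → ZMod 2) : BlockUnitri n := ⟨0, 0, Matrix.diagonal γ, 0, 0, 0⟩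

lemma ofDiagonal_zero : ofDiagonal (0 : Fin n → ZMod 2) = 1 := by
  ext1 <;> simp [ofDiagonal]

lemma ofDiagonal_mul (γ δ : Fin n → ZMod 2) :
    ofDiagonal γ * ofDiagonal δ = ofDiagonal (γ + δ) := by
  ext1 <;> simp [ofDiagonal]

/-- The elements whose squares correspond to the diagonal matrix units. -/
def unitRoot (n i : ℕ) : BlockUnitri n :=
  ⟨Matrix.of fun j _ => if (j : ℕ) = i then 1 else 0,
    Matrix.of fun _ j => if (j : ℕ) = i then 1 else 0, 0, 0, 0, 0⟩

lemma sqCore_unitRoot (n i : ℕ) :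
    sqCore (unitRoot n i) = (Matrix.diagonal fun j : Fin n => if (j : ℕ) = i then 1 else 0, 0, 0) := by
  have : (unitRoot n i).a * (unitRoot n i).b =
      Matrix.diagonal fun j : Fin n => if (j : ℕ) = i then 1 else 0 := by
    ext j k
    rw [Matrix.mul_apply, Matrix.diagonal_apply]
    by_cases hjk : j = k
    · subst hjk
      by_cases hj : (j : ℕ) = i <;> simp [unitRoot, hj]
    · by_cases hj : (j : ℕ) = i
      · have hk : (k : ℕ) ≠ i := fun hk => hjk (Fin.ext (hj.trans hk.symm))
        simp [unitRoot, hk, hjk]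
      · simp [unitRoot, hj, hjk]
  rw [sqCore, this]
  simp [unitRoot]

lemma conjMix_ofDiagonal (γ : Fin n → ZMod 2) (S : Finset ℕ) :
    conjMix (ofDiagonal γ) (∑ i ∈ S, sqCore (unitRoot n i)) =
      Matrix.diagonal fun j : Fin n => (if (j : ℕ) ∈ S then 1 else 0) *
        (tailIndicator n j + γ j * headIndicator n j) := by
  have h : ∑ i ∈ S, sqCore (unitRoot n i) =
      (Matrix.diagonal fun j : Fin n => if (j : ℕ) ∈ S then 1 else 0, 0, 0) := by
    simp only [sqCore_unitRoot]
    refine Prod.ext ?_ (Prod.ext ?_ ?_)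
    · rw [Prod.fst_sum]
      ext j k
      rw [Matrix.sum_apply]
      by_cases hjk : j = k <;> simp [hjk]
    · rw [Prod.snd_sum, Prod.fst_sum]; simp
    · rw [Prod.snd_sum, Prod.snd_sum]; simp
  rw [h]
  simp [conjMix, mix, ofDiagonal, Matrix.diagonal_mul_diagonal, mul_add]

lemma sum_det_conjMix_ofDiagonal (γ : Fin n → ZMod 2) :
    ∑ S ∈ (Finset.range n).powerset,
      (conjMix (ofDiagonal γ) (∑ i ∈ S, sqCore (unitRoot n i))).det =
      ∏ j : Fin n, (tailIndicator n j + γ j * headIndicator n j) := by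
  rw [Finset.sum_eq_single (Finset.range n)]
  · rw [conjMix_ofDiagonal, Matrix.det_diagonal]
    simp
  · intro S hS hne
    rw [conjMix_ofDiagonal, Matrix.det_diagonal]
    obtain ⟨j, hj, hjS⟩ := Finset.exists_of_ssubset
      ((Finset.mem_powerset.1 hS).ssubset_of_ne hne)
    exact Finset.prod_eq_zero (Finset.mem_univ ⟨j, Finset.mem_range.1 hj⟩) (by simp [hjS])
  · intro h
    simp at h

end BlockUnitri

/-- The value of the quadratic functional at an iterated translate sum. -/
lemma sum_add_lsh_mul {L : Type} [Group L] [Fintype L] (k : L) (f Ψ : L → ZMod 2) :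
    ∑ g, (f + lsh k f) g * Ψ g = ∑ g, f g * (Ψ g + Ψ (k * g)) := by
  simp only [Pi.add_apply, add_mul, mul_add, Finset.sum_add_distrib]
  congr 1
  rw [← Equiv.sum_comp (Equiv.mulLeft k)]
  simp [lsh]

lemma TwistedExt.commutator_three_k {L : Type} [Group L] [Fintype L] {τ : L → L → ZMod 2}
    {y : TwistedExt τ} (hy : y.k = 1) (t₁ t₂ t₃ : TwistedExt τ) :
    ⁅⁅⁅y, t₁⁆, t₂⁆, t₃⁆.k = 1 := by
  simp only [commutator_k, hy, commutatorElement_one_left]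

lemma TwistedExt.sum_commutator_three_mul {L : Type} [Group L] [Fintype L] [DecidableEq L]
    {τ : L → L → ZMod 2} {y : TwistedExt τ} (hy : y.k = 1) (hf : y.f = Pi.single 1 1)
    (t₁ t₂ t₃ : TwistedExt τ) (Ψ : L → ZMod 2) :
    ∑ g, ⁅⁅⁅y, t₁⁆, t₂⁆, t₃⁆.f g * Ψ g =
      Ψ 1 + Ψ t₃.k + (Ψ t₂.k + Ψ (t₃.k * t₂.k)) +
        (Ψ t₁.k + Ψ (t₃.k * t₁.k) + (Ψ (t₂.k * t₁.k) + Ψ (t₃.k * (t₂.k * t₁.k)))) := by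
  have h1 : ⁅y, t₁⁆.k = 1 := by simp only [commutator_k, hy, commutatorElement_one_left]
  have h2 : ⁅⁅y, t₁⁆, t₂⁆.k = 1 := by simp only [commutator_k, hy, commutatorElement_one_left]
  rw [commutator_f h2, sum_add_lsh_mul, commutator_f h1, sum_add_lsh_mul, commutator_f hy,
    sum_add_lsh_mul, hf, Finset.sum_eq_single 1 (fun g _ hg => by simp [hg]) (by simp)]
  simp

namespace BlockUnitri

variable {n : ℕ}

lemma prod_tail_add_head (hn : 3 < n) (γ : Fin n → ZMod 2) :
    ∏ j : Fin n, (tailIndicator n j + γ j * headIndicator n j) =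
      γ ⟨0, by omega⟩ * γ ⟨1, by omega⟩ * γ ⟨2, by omega⟩ := by
  obtain ⟨k, rfl⟩ : ∃ k, n = k + 3 := ⟨n - 3, by omega⟩
  have h : ∀ j, tailIndicator (k + 3) j + γ j * headIndicator (k + 3) j =
      if (j : ℕ) < 3 then γ j else 1 := by
    intro j
    unfold tailIndicator headIndicator
    split_ifs <;> simp
  simp only [h]
  rw [Fin.prod_univ_succ, Fin.prod_univ_succ, Fin.prod_univ_succ,
    Finset.prod_eq_one fun j _ => if_neg (by simp only [Fin.val_succ]; omega), mul_one,
    ← mul_assoc, if_pos (by simp), if_pos (by simp),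
    if_pos (by simp only [Fin.val_succ, Fin.val_zero]; omega)]
  rfl

end BlockUnitri

open BlockUnitri in
/-- For every `n > 3` there is a group which satisfies the common laws and the square laws of
all lengths sufficiently different from `n`, but not the square law of length `n`. -/
lemma exists_group_separating {n : ℕ} (hn : 3 < n) :
    ∃ (G : Type) (_ : Group G), derivedSeries G 4 = ⊥ ∧
      (∀ x y z : G, ⁅⁅x ^ 4, y ^ 4⁆, z ^ 4⁆ = 1) ∧
      (∀ m, m + 3 < n ∨ n < m → SatisfiesSquareLaw m G) ∧ ¬ SatisfiesSquareLaw n G := by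
  classical
  obtain ⟨τ, hτ⟩ := exists_kernel (twist_inv (n := n)) (twist_one (by omega))
  have hsq : ∀ {u : TwistedExt τ} (_ : u.k = 1) (z : ℕ → TwistedExt τ) (m : ℕ),
      ⁅u, squareCommutator u z m⁆ = 1 ↔ ∑ g, u.f g * ∑ S ∈ (Finset.range m).powerset,
        (conjMix g (∑ i ∈ S, sqCore (z i).k)).det = 0 := by
    intro u hu z m
    simp only [← twist_conj_ofCore]
    exact TwistedExt.commutator_squareCommutator_eq_one_iff twist_inv hτ ofCore_zero ofCore_add
      ofCore_mul_self hu (fun i => sq_eq_ofCore _) m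
  refine ⟨TwistedExt τ, inferInstance, TwistedExt.derivedSeries_four derivedSeries_two,
    fun x y z => ?_, fun m hm y t₁ t₂ t₃ z => ?_, fun h => ?_⟩
  · have hk : ∀ w : TwistedExt τ, (w ^ 4).k = 1 := fun w => by rw [TwistedExt.pow_k, pow_four]
    obtain ⟨h1, h2⟩ := TwistedExt.commutator_of_mem (hk x) (hk y)
    rw [commutatorElement_eq_one_iff_mul_comm]
    exact TwistedExt.mul_comm_of_f_eq_zero h2 h1 (hk z)
  · rw [hsq (by simp only [TwistedExt.commutator_k, commutator_four])]
    exact Finset.sum_eq_zero fun g _ => by rw [sum_det_conjMix_eq_zero hm, mul_zero]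
  · let t (i : Fin n) : TwistedExt τ := ⟨0, 0, ofDiagonal (Pi.single i 1)⟩
    let y : TwistedExt τ := ⟨Pi.single 1 1, 0, 1⟩
    let z (i : ℕ) : TwistedExt τ := ⟨0, 0, unitRoot n i⟩
    have hy : y.k = 1 := rfl
    have key := (hsq (TwistedExt.commutator_three_k hy (t ⟨0, by omega⟩) (t ⟨1, by omega⟩)
      (t ⟨2, by omega⟩)) z n).1 (h _ _ _ _ _)
    rw [TwistedExt.sum_commutator_three_mul hy rfl] at key
    simp only [t, z, ← ofDiagonal_zero, ofDiagonal_mul, sum_det_conjMix_ofDiagonal,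
      prod_tail_add_head hn] at key
    simp at key

lemma lawVariety_injective : Function.Injective lawVariety.{u} := by
  have hle : ∀ S S' : Set ℕ, lawVariety.{u} S = lawVariety S' → S ⊆ S' := by
    intro S S' h j hj
    by_contra hj'
    have h5 : 5 ≤ 5 ^ (j + 1) := Nat.le_self_pow (by omega) 5
    obtain ⟨G, _, hd, hp, hs, hn⟩ := exists_group_separating (n := 5 ^ (j + 1)) (by omega)
    have hG : SatisfiesLaws S' G := by
      refine ⟨hd, hp, fun i hi => hs _ ?_⟩
      have hij : i ≠ j := fun hij => hj' (hij ▸ hi)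
      rcases lt_or_gt_of_ne hij with hlt | hlt
      · left
        have h1 : 5 ^ (i + 2) ≤ 5 ^ (j + 1) := Nat.pow_le_pow_right (by norm_num) (by omega)
        have h2 : 5 ≤ 5 ^ (i + 1) := Nat.le_self_pow (by omega) 5
        rw [pow_succ] at h1
        omega
      · right
        exact Nat.pow_lt_pow_right (by norm_num) (by omega)
    have e : ULift.{u} G ≃* G := MulEquiv.ulift
    have h1 : (lawVariety.{u} S').Mem ⟨ULift.{u} G⟩ :=
      hG.of_injective e.toMonoidHom e.injective
    rw [← h] at h1
    have h2 : SatisfiesLaws S G := SatisfiesLaws.of_injective e.symm.toMonoidHom e.symm.injective h1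
    exact hn (h2.square j hj)
  exact fun S S' h => (hle S S' h).antisymm (hle S' S h.symm)

theorem stmt13 :
    ¬ Set.Countable {V : GroupVariety.{u} |
        (∀ G : GroupT.{u}, V.Mem G → IsSolvable G.carrier) ∧
        HasNontrivialDominions V.Mem} := by
  intro h
  have := h.to_subtype
  let f : Set ℕ → {V : GroupVariety.{u} |
      (∀ G : GroupT.{u}, V.Mem G → IsSolvable G.carrier) ∧ HasNontrivialDominions V.Mem} :=
    fun S => ⟨lawVariety S, fun _ hG => ⟨4, hG.derived⟩, hasNontrivialDominions_lawVariety S⟩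
  have hf : Function.Injective f := fun S S' h => lawVariety_injective (congrArg Subtype.val h)
  have := hf.countable
  obtain ⟨g, hg⟩ := exists_injective_nat (Set ℕ)
  exact Function.cantor_injective g hg
end

section
/- Let 𝒩 be a variety of groups with instances of nontrivial dominions, and let 𝒬 be any variety of groups different from the variety of all groups (i.e., some group does not belong to 𝒬). Then the product variety 𝒩𝒬 also has instances of nontrivial dominions. -/
namespace GroupVariety

variable (V : GroupVariety.{u})

theorem mem_of_surjective {A B : Type u} [Group A] [Group B] (f : A →* B)
    (hf : Function.Surjective f) (hA : V.Mem ⟨A⟩) : V.Mem ⟨B⟩ :=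
  V.quotient_closed ⟨A⟩ ⟨B⟩ f hf hA

theorem mem_of_injective {A B : Type u} [Group A] [Group B] (f : A →* B)
    (hf : Function.Injective f) (hB : V.Mem ⟨B⟩) : V.Mem ⟨A⟩ :=
  V.iso_closed (G := ⟨f.range⟩) (H := ⟨A⟩) (MonoidHom.ofInjective hf).symm
    (V.subgroup_closed ⟨B⟩ f.range hB)

theorem mem_prod {A B : Type u} [Group A] [Group B] (hA : V.Mem ⟨A⟩) (hB : V.Mem ⟨B⟩) :
    V.Mem ⟨A × B⟩ := by
  let F : ULift.{u} Bool → GroupT.{u} := fun b => if b.down then ⟨A⟩ else ⟨B⟩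
  have hF : ∀ b, V.Mem (F b) := by
    rintro ⟨_ | _⟩
    exacts [hB, hA]
  let e : (∀ b, (F b).carrier) →* A × B :=
    (Pi.evalMonoidHom (fun b => (F b).carrier) ⟨true⟩).prod
      (Pi.evalMonoidHom (fun b => (F b).carrier) ⟨false⟩)
  refine V.mem_of_surjective e (fun x => ⟨fun b => ?_, ?_⟩) (V.pi_closed _ F hF)
  · exact match b with
      | ⟨true⟩ => x.1
      | ⟨false⟩ => x.2
  · rfl

variable {A B : Type u} [Group A] [Group B]

theorem map_eq_one_of_mem_verbalSubgroup (f : A →* B) (hB : V.Mem ⟨B⟩) {a : A}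
    (ha : a ∈ verbalSubgroup V A) : f a = 1 := by
  have h : a ∈ f.ker := by
    simp only [verbalSubgroup, Subgroup.mem_iInf] at ha
    exact ha f.ker ⟨inferInstance,
      V.mem_of_injective (QuotientGroup.kerLift f) (QuotientGroup.kerLift_injective f) hB⟩
  exact h

theorem map_mem_verbalSubgroup (f : A →* B) {a : A} (ha : a ∈ verbalSubgroup V A) :
    f a ∈ verbalSubgroup V B := by
  simp only [verbalSubgroup, Subgroup.mem_iInf]
  rintro M ⟨hM, hMem⟩
  exact (QuotientGroup.eq_one_iff _).1
    (V.map_eq_one_of_mem_verbalSubgroup ((QuotientGroup.mk' M).comp f) hMem ha)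

instance verbalSubgroup_characteristic : (verbalSubgroup V A).Characteristic :=
  Subgroup.characteristic_iff_le_comap.2 fun φ _ ha =>
    V.map_mem_verbalSubgroup φ.toMonoidHom ha

theorem mem_quotient_verbalSubgroup : V.Mem ⟨A ⧸ verbalSubgroup V A⟩ := by
  let ι : Type u := {M : Subgroup A // ∃ h : M.Normal, (letI := h; V.Mem ⟨A ⧸ M⟩)}
  have hn (i : ι) : i.1.Normal := i.2.1
  have hprod := V.pi_closed ι (fun i => ⟨A ⧸ i.1⟩) (fun i => i.2.2)
  let e : A →* (∀ i : ι, A ⧸ i.1) := MonoidHom.pi fun i => QuotientGroup.mk' i.1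
  have hker : e.ker = verbalSubgroup V A := by
    ext a
    simp only [verbalSubgroup, Subgroup.mem_iInf, MonoidHom.mem_ker]
    constructor
    · intro h M hM
      have := hM.1
      exact (QuotientGroup.eq_one_iff _).1 (congrFun h (⟨M, hM⟩ : ι))
    · intro h
      funext i
      exact (QuotientGroup.eq_one_iff _).2 (h i.1 i.2)
  exact V.mem_of_injective
    ((QuotientGroup.kerLift e).comp (QuotientGroup.quotientMulEquivOfEq hker.symm).toMonoidHom)
    ((QuotientGroup.kerLift_injective e).comp (MulEquiv.injective _)) hprod

/-- Dominions lift along surjections: maps that agree on the preimage of `H` agree on the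
preimage of its dominion. -/
theorem eq_of_map_mem_dominion {G K R : Type u} [Group G] [Group K] [Group R] (hK : V.Mem ⟨K⟩)
    (ψ : R →* G) (hψ : Function.Surjective ψ) (H : Subgroup G) (p q : R →* K)
    (hpq : ∀ r, ψ r ∈ H → p r = q r) {r : R} (hr : ψ r ∈ dominion V.Mem G H) : p r = q r := by
  let π := QuotientGroup.mk' (verbalSubgroup V R)
  let P := p.prod π
  let Q := q.prod π
  let M : Subgroup (K × (R ⧸ verbalSubgroup V R)) := ψ.ker.map P
  have hPQ : ∀ s, ψ s ∈ H → P s = Q s := fun s hs => Prod.ext (hpq s hs) rfl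
  have hM : M = ψ.ker.map Q := by
    ext x
    simp only [M, Subgroup.mem_map]
    refine exists_congr fun s => and_congr_right fun hs => ?_
    rw [hPQ s (by rw [MonoidHom.mem_ker.1 hs]; exact H.one_mem)]
  let L := Subgroup.normalizer (M : Set (K × (R ⧸ verbalSubgroup V R)))
  have hP : ∀ s, P s ∈ L := fun s =>
    Subgroup.le_normalizer_map P ⟨s, by rw [Subgroup.normalizer_eq_top]; trivial, rfl⟩
  have hQ : ∀ s, Q s ∈ L := fun s => by
    simp only [L, hM]
    exact Subgroup.le_normalizer_map Q ⟨s, by rw [Subgroup.normalizer_eq_top]; trivial, rfl⟩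
  have hL : V.Mem ⟨L ⧸ M.subgroupOf L⟩ :=
    V.mem_of_surjective (QuotientGroup.mk' _) (QuotientGroup.mk'_surjective _)
      (V.subgroup_closed ⟨_⟩ L (V.mem_prod hK V.mem_quotient_verbalSubgroup))
  let P' : R →* L ⧸ M.subgroupOf L := (QuotientGroup.mk' _).comp (P.codRestrict L hP)
  let Q' : R →* L ⧸ M.subgroupOf L := (QuotientGroup.mk' _).comp (Q.codRestrict L hQ)
  have hP' : ψ.ker ≤ P'.ker := fun s hs =>
    (QuotientGroup.eq_one_iff _).2 (Subgroup.mem_subgroupOf.2 ⟨s, hs, rfl⟩)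
  have hQ' : ψ.ker ≤ Q'.ker := fun s hs =>
    (QuotientGroup.eq_one_iff _).2 (Subgroup.mem_subgroupOf.2 (by rw [hM]; exact ⟨s, hs, rfl⟩))
  have key := hr ⟨L ⧸ M.subgroupOf L⟩ hL (ψ.liftOfSurjective hψ ⟨P', hP'⟩)
    (ψ.liftOfSurjective hψ ⟨Q', hQ'⟩) (fun h hh => by
      obtain ⟨s, rfl⟩ := hψ h
      simp only [MonoidHom.liftOfSurjective, MonoidHom.liftOfRightInverse_comp_apply]
      exact congrArg (QuotientGroup.mk' _) (Subtype.ext (hPQ s hh)))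
  simp only [MonoidHom.liftOfSurjective, MonoidHom.liftOfRightInverse_comp_apply] at key
  obtain ⟨n, -, hn⟩ := Subgroup.mem_subgroupOf.1 (QuotientGroup.eq.1 key)
  have h₁ : p n = (p r)⁻¹ * q r := congrArg Prod.fst hn
  have h₂ : π n = (π r)⁻¹ * π r := congrArg Prod.snd hn
  rw [inv_mul_cancel] at h₂
  rw [V.map_eq_one_of_mem_verbalSubgroup p hK ((QuotientGroup.eq_one_iff n).1 h₂)] at h₁
  exact inv_mul_eq_one.1 h₁.symm

/-- In a suitable free group, the verbal subgroup of a proper variety maps onto any given group. -/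
theorem exists_surjective_verbalSubgroup_freeGroup (hV : ∃ G : GroupT.{u}, ¬ V.Mem G)
    (G : Type u) [Group G] :
    ∃ (Y : Type u) (ψ : verbalSubgroup V (FreeGroup Y) →* G), Function.Surjective ψ := by
  classical
  obtain ⟨X, hX⟩ := hV
  have hne : verbalSubgroup V (FreeGroup X.carrier) ≠ ⊥ := by
    intro hbot
    have hmem : V.Mem ⟨FreeGroup X.carrier⟩ := by
      refine V.mem_of_injective (QuotientGroup.mk' (verbalSubgroup V (FreeGroup X.carrier))) ?_
        V.mem_quotient_verbalSubgroup
      rw [← MonoidHom.ker_eq_bot_iff, QuotientGroup.ker_mk', hbot]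
    exact hX (V.mem_of_surjective (FreeGroup.lift id) (fun x => ⟨FreeGroup.of x, by simp⟩) hmem)
  obtain ⟨w, hw, hw1⟩ := (Subgroup.bot_or_exists_ne_one _).resolve_left hne
  let T : Type u := Set (ℕ × G)
  let Y : Type u := X.carrier × T
  let R := verbalSubgroup V (FreeGroup Y)
  let c : T → R := fun t => ⟨FreeGroup.map (fun x => (x, t)) w, V.map_mem_verbalSubgroup _ hw⟩
  have hc : Function.Injective c := by
    intro s t hst
    by_contra hne
    let ρ : FreeGroup Y →* FreeGroup X.carrier :=
      FreeGroup.lift fun y => if y.2 = s then FreeGroup.of y.1 else 1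
    have hs : ρ.comp (FreeGroup.map fun x => (x, s)) = MonoidHom.id _ := by
      ext x
      simp [ρ]
    have ht : ρ.comp (FreeGroup.map fun x => (x, t)) = 1 := by
      ext x
      simp [ρ, Ne.symm hne]
    have h := congrArg (fun z : R => ρ z.1) hst
    exact hw1 ((DFunLike.congr_fun hs w).symm.trans (h.trans (DFunLike.congr_fun ht w)))
  let I := IsFreeGroup.Generators R
  let e : R ≃* FreeGroup I := IsFreeGroup.toFreeGroup R
  have hTI : Cardinal.mk T ≤ Cardinal.mk (FreeGroup I) :=
    Cardinal.mk_le_of_injective (e.injective.comp hc)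
  have hlt : Cardinal.mk (ℕ × G) < Cardinal.mk T := by
    rw [Cardinal.mk_set]
    exact Cardinal.cantor _
  have hω : Cardinal.aleph0 ≤ Cardinal.mk (ℕ × G) := Cardinal.aleph0_le_mk _
  have hI : Cardinal.mk (ℕ × G) ≤ Cardinal.mk I := by
    have h := hlt.trans_le hTI
    rcases isEmpty_or_nonempty I with hE | hE
    · exact absurd (hω.trans h.le) (not_le.2 (Cardinal.lt_aleph0_of_finite _))
    · rw [Cardinal.mk_freeGroup, lt_max_iff] at h
      exact (h.resolve_right hω.not_gt).le
  obtain ⟨j⟩ := hI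
  let k : G → I := fun g => j (0, g)
  have hk : Function.Injective k := fun a b h => (Prod.ext_iff.1 (j.injective h)).2
  refine ⟨Y, (FreeGroup.lift (Function.invFun k)).comp e.toMonoidHom, fun g => ?_⟩
  refine ⟨e.symm (FreeGroup.of (k g)), ?_⟩
  simp [Function.leftInverse_invFun hk g]

end GroupVariety

theorem stmt18 (𝒩 𝒬 : GroupVariety.{u}) (h𝒩 : HasNontrivialDominions 𝒩.Mem)
    (h𝒬 : ∃ G : GroupT.{u}, ¬ 𝒬.Mem G) :
    HasNontrivialDominions (ProductVariety 𝒩 𝒬) := by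
  obtain ⟨G, H, hG, hsub, hnot⟩ := h𝒩
  obtain ⟨a, ha, haH⟩ := Set.not_subset.1 hnot
  obtain ⟨Y, ψ, hψ⟩ := 𝒬.exists_surjective_verbalSubgroup_freeGroup h𝒬 G.carrier
  let R := verbalSubgroup 𝒬 (FreeGroup Y)
  let M : Subgroup (FreeGroup Y) := (verbalSubgroup 𝒩 R).map R.subtype
  let π : FreeGroup Y →* FreeGroup Y ⧸ M := QuotientGroup.mk' M
  let τ : R →* FreeGroup Y ⧸ M := π.comp R.subtype
  have hτ : ∀ r : R, τ r = 1 → r ∈ verbalSubgroup 𝒩 R := by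
    intro r hr
    obtain ⟨s, hs, hsr⟩ := (QuotientGroup.eq_one_iff _).1 hr
    rwa [← Subtype.ext hsr]
  obtain ⟨r, rfl⟩ := hψ a
  refine ⟨⟨FreeGroup Y ⧸ M⟩, (H.comap ψ).map τ, ⟨R.map π, ?_, ?_, ?_⟩, ?_, ?_⟩
  · exact Subgroup.Normal.map inferInstance π (QuotientGroup.mk'_surjective M)
  · refine 𝒩.mem_of_surjective (QuotientGroup.lift (verbalSubgroup 𝒩 R) (π.subgroupMap R) ?_) ?_
      𝒩.mem_quotient_verbalSubgroup
    · intro s hs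
      exact Subtype.ext ((QuotientGroup.eq_one_iff _).2 ⟨s, hs, rfl⟩)
    · exact QuotientGroup.lift_surjective_of_surjective _ _ (π.subgroupMap_surjective R) _
  · have := Subgroup.Normal.map (inferInstance : R.Normal) π (QuotientGroup.mk'_surjective M)
    refine 𝒬.mem_of_surjective (QuotientGroup.map R (R.map π) π (Subgroup.le_comap_map _ _)) ?_
      𝒬.mem_quotient_verbalSubgroup
    exact QuotientGroup.map_surjective_of_surjective _ _ _
      ((QuotientGroup.mk'_surjective _).comp (QuotientGroup.mk'_surjective M)) _
  · exact fun x hx K _ f g hfg => hfg x hx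
  · intro hle
    have hmem : τ r ∈ (H.comap ψ).map τ := by
      refine hle ?_
      rintro K ⟨N, hN, hN𝒩, hN𝒬⟩ f g hfg
      have hrange (f : FreeGroup Y ⧸ M →* K.carrier) (s : R) : f (τ s) ∈ N :=
        (QuotientGroup.eq_one_iff _).1 (𝒬.map_eq_one_of_mem_verbalSubgroup
          ((QuotientGroup.mk' N).comp (f.comp π)) hN𝒬 s.2)
      exact congrArg Subtype.val (𝒩.eq_of_map_mem_dominion hN𝒩 ψ hψ H
        ((f.comp τ).codRestrict N (hrange f)) ((g.comp τ).codRestrict N (hrange g))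
        (fun s hs => Subtype.ext (hfg _ ⟨s, hs, rfl⟩)) ha)
    obtain ⟨s, hs, hsr⟩ := hmem
    have h1 : ψ (s⁻¹ * r) = 1 :=
      𝒩.map_eq_one_of_mem_verbalSubgroup ψ hG (hτ _ (by rw [map_mul, map_inv, hsr, inv_mul_cancel]))
    rw [map_mul, map_inv, inv_mul_eq_one] at h1
    exact haH (h1 ▸ hs)
end
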